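/- arXiv:1911.02097 — 5 statements merged into one kernel-verified Lean document; each statement's English description precedes it below -/
import Mathlib

section
/- Let ε ∈ {−1,1} and δ₁,…,δ₇ ∈ ℝ with δ₁(δ₃² + δ₄²) ≠ 0, and set Δ = (δ₃² + δ₄²)/δ₁². Suppose u, v, h : ℝ³ → ℝ and b : ℝ² → ℝ are smooth and (u,v,h) is a solution of the shallow water system with bottom topography b on ℝ × ℝ². Define the invertible affine map Φ(t,x,y) = (δ₁t + δ₂, δ₃x − εδ₄y + δ₅, δ₄x + εδ₃y + δ₆) of ℝ³ and functions ũ, ṽ, h̃ : ℝ³ → ℝ and b̃ : ℝ² → ℝ by ũ(Φ(t,x,y)) = (δ₃u(t,x,y) − εδ₄v(t,x,y))/δ₁, ṽ(Φ(t,x,y)) = (δ₄u(t,x,y) + εδ₃v(t,x,y))/δ₁, h̃(Φ(t,x,y)) = Δ·h(t,x,y), and b̃(δ₃x − εδ₄y + δ₅, δ₄x + εδ₃y + δ₆) = Δ·b(x,y) + δ₇. Then (ũ, ṽ, h̃) is a solution of the shallow water system with bottom topography b̃ on ℝ × ℝ². -/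
noncomputable section

open Real Set

/-- Partial derivative with respect to the first (time) variable. -/
def pdt (f : ℝ → ℝ → ℝ → ℝ) (t x y : ℝ) : ℝ := deriv (fun s => f s x y) t

/-- Partial derivative with respect to the second (x) variable. -/
def pdx (f : ℝ → ℝ → ℝ → ℝ) (t x y : ℝ) : ℝ := deriv (fun s => f t s y) x

/-- Partial derivative with respect to the third (y) variable. -/
def pdy (f : ℝ → ℝ → ℝ → ℝ) (t x y : ℝ) : ℝ := deriv (fun s => f t x s) y

/-- Partial derivative of a function of (x,y) with respect to x. -/
def pbx (b : ℝ → ℝ → ℝ) (x y : ℝ) : ℝ := deriv (fun s => b s y) x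

/-- Partial derivative of a function of (x,y) with respect to y. -/
def pby (b : ℝ → ℝ → ℝ) (x y : ℝ) : ℝ := deriv (fun s => b x s) y

/-- `(u,v,h)` is a (smooth) solution of the two-dimensional shallow water system with
bottom topography `b` on `I × Ω`:
`u_t + u u_x + v u_y + h_x = b_x`, `v_t + u v_x + v v_y + h_y = b_y`,
`h_t + (u h)_x + (v h)_y = 0` at every point of `I × Ω`. -/
def IsSWSolution (I : Set ℝ) (Ω : Set (ℝ × ℝ)) (b : ℝ → ℝ → ℝ)
    (u v h : ℝ → ℝ → ℝ → ℝ) : Prop :=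
  ContDiffOn ℝ (⊤ : ℕ∞) (fun p : ℝ × ℝ => b p.1 p.2) Ω ∧
  ContDiffOn ℝ (⊤ : ℕ∞) (fun p : ℝ × ℝ × ℝ => u p.1 p.2.1 p.2.2) (I ×ˢ Ω) ∧
  ContDiffOn ℝ (⊤ : ℕ∞) (fun p : ℝ × ℝ × ℝ => v p.1 p.2.1 p.2.2) (I ×ˢ Ω) ∧
  ContDiffOn ℝ (⊤ : ℕ∞) (fun p : ℝ × ℝ × ℝ => h p.1 p.2.1 p.2.2) (I ×ˢ Ω) ∧
  ∀ t x y : ℝ, t ∈ I → (x, y) ∈ Ω →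
    pdt u t x y + u t x y * pdx u t x y + v t x y * pdy u t x y + pdx h t x y = pbx b x y ∧
    pdt v t x y + u t x y * pdx v t x y + v t x y * pdy v t x y + pdy h t x y = pby b x y ∧
    pdt h t x y + pdx (fun t x y => u t x y * h t x y) t x y
      + pdy (fun t x y => v t x y * h t x y) t x y = 0

/-- Chain rule along a curve, in terms of the partial derivatives of a function of three real
variables. -/
theorem hasDerivAt_comp_curve {f : ℝ → ℝ → ℝ → ℝ}
    (hf : Differentiable ℝ (fun p : ℝ × ℝ × ℝ => f p.1 p.2.1 p.2.2))
    {α β γ : ℝ → ℝ} {α' β' γ' s : ℝ}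
    (hα : HasDerivAt α α' s) (hβ : HasDerivAt β β' s) (hγ : HasDerivAt γ γ' s) :
    HasDerivAt (fun r => f (α r) (β r) (γ r))
      (pdt f (α s) (β s) (γ s) * α' + pdx f (α s) (β s) (γ s) * β'
        + pdy f (α s) (β s) (γ s) * γ') s := by
  set L := fderiv ℝ (fun p : ℝ × ℝ × ℝ => f p.1 p.2.1 p.2.2) (α s, β s, γ s)
  have along : ∀ {a b c : ℝ → ℝ} {a' b' c' r : ℝ}, HasDerivAt a a' r → HasDerivAt b b' r →
      HasDerivAt c c' r → a r = α s → b r = β s → c r = γ s →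
      HasDerivAt (fun r => f (a r) (b r) (c r)) (L (a', b', c')) r := by
    intro a b c a' b' c' r ha hb hc ea eb ec
    refine HasFDerivAt.comp_hasDerivAt (l := fun p : ℝ × ℝ × ℝ => f p.1 p.2.1 p.2.2)
      (f := fun r => (a r, b r, c r)) r ?_ (ha.prodMk (hb.prodMk hc))
    simp only [ea, eb, ec]
    exact (hf _).hasFDerivAt
  have ht : pdt f (α s) (β s) (γ s) = L (1, 0, 0) :=
    (along (hasDerivAt_id' _) (hasDerivAt_const _ _) (hasDerivAt_const _ _) rfl rfl rfl).deriv
  have hx : pdx f (α s) (β s) (γ s) = L (0, 1, 0) :=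
    (along (hasDerivAt_const _ _) (hasDerivAt_id' _) (hasDerivAt_const _ _) rfl rfl rfl).deriv
  have hy : pdy f (α s) (β s) (γ s) = L (0, 0, 1) :=
    (along (hasDerivAt_const _ _) (hasDerivAt_const _ _) (hasDerivAt_id' _) rfl rfl rfl).deriv
  have hsplit : ((α', β', γ') : ℝ × ℝ × ℝ)
      = α' • (1, 0, 0) + β' • (0, 1, 0) + γ' • (0, 0, 1) := by simp
  have key := along hα hβ hγ rfl rfl rfl
  rw [hsplit, map_add, map_add, map_smul, map_smul, map_smul] at key
  rw [ht, hx, hy]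
  convert key using 1
  simp only [smul_eq_mul]
  ring

/-- The partial derivatives of a function of three real variables after an affine change of
variables that does not mix time and space. -/
theorem hasDerivAt_affine_change {f : ℝ → ℝ → ℝ → ℝ}
    (hf : Differentiable ℝ (fun p : ℝ × ℝ × ℝ => f p.1 p.2.1 p.2.2))
    (a a₀ c₁ c₂ c₀ d₁ d₂ d₀ t x y : ℝ) :
    let P := a * t + a₀
    let Q := c₁ * x + c₂ * y + c₀
    let R := d₁ * x + d₂ * y + d₀
    HasDerivAt (fun s => f (a * s + a₀) Q R) (a * pdt f P Q R) t ∧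
    HasDerivAt (fun s => f P (c₁ * s + c₂ * y + c₀) (d₁ * s + d₂ * y + d₀))
      (c₁ * pdx f P Q R + d₁ * pdy f P Q R) x ∧
    HasDerivAt (fun s => f P (c₁ * x + c₂ * s + c₀) (d₁ * x + d₂ * s + d₀))
      (c₂ * pdx f P Q R + d₂ * pdy f P Q R) y := by
  intro P Q R
  have lin : ∀ k r : ℝ, HasDerivAt (fun s => k * s) k r := fun k r => by
    simpa using (hasDerivAt_id' r).const_mul k
  refine ⟨?_, ?_, ?_⟩
  · convert hasDerivAt_comp_curve hf ((lin a t).add_const a₀) (hasDerivAt_const t Q)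
      (hasDerivAt_const t R) using 1
    ring
  · convert hasDerivAt_comp_curve hf (hasDerivAt_const x P)
      (((lin c₁ x).add_const (c₂ * y)).add_const c₀)
      (((lin d₁ x).add_const (d₂ * y)).add_const d₀) using 1
    ring
  · convert hasDerivAt_comp_curve hf (hasDerivAt_const y P)
      (((lin c₂ y).const_add (c₁ * x)).add_const c₀)
      (((lin d₂ y).const_add (d₁ * x)).add_const d₀) using 1
    ring

/-- the point equivalence transformations of the class of two-dimensional
shallow water systems with variable bottom topography map solutions to solutions. -/
theorem stmt_0 (ε δ1 δ2 δ3 δ4 δ5 δ6 δ7 : ℝ) (hε : ε = 1 ∨ ε = -1)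
    (hδ : δ1 * (δ3 ^ 2 + δ4 ^ 2) ≠ 0)
    (u v h : ℝ → ℝ → ℝ → ℝ) (b : ℝ → ℝ → ℝ)
    (hsol : IsSWSolution Set.univ Set.univ b u v h)
    (ut vt ht : ℝ → ℝ → ℝ → ℝ) (bt : ℝ → ℝ → ℝ)
    (hut : ∀ t x y : ℝ, ut (δ1 * t + δ2) (δ3 * x - ε * δ4 * y + δ5) (δ4 * x + ε * δ3 * y + δ6)
      = (δ3 * u t x y - ε * δ4 * v t x y) / δ1)
    (hvt : ∀ t x y : ℝ, vt (δ1 * t + δ2) (δ3 * x - ε * δ4 * y + δ5) (δ4 * x + ε * δ3 * y + δ6)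
      = (δ4 * u t x y + ε * δ3 * v t x y) / δ1)
    (hht : ∀ t x y : ℝ, ht (δ1 * t + δ2) (δ3 * x - ε * δ4 * y + δ5) (δ4 * x + ε * δ3 * y + δ6)
      = ((δ3 ^ 2 + δ4 ^ 2) / δ1 ^ 2) * h t x y)
    (hbt : ∀ x y : ℝ, bt (δ3 * x - ε * δ4 * y + δ5) (δ4 * x + ε * δ3 * y + δ6)
      = ((δ3 ^ 2 + δ4 ^ 2) / δ1 ^ 2) * b x y + δ7) :
    IsSWSolution Set.univ Set.univ bt ut vt ht := by
  have hδ1 : δ1 ≠ 0 := left_ne_zero_of_mul hδ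
  have hN : δ3 ^ 2 + δ4 ^ 2 ≠ 0 := right_ne_zero_of_mul hδ
  have hεε : ε * ε = 1 := by rcases hε with rfl | rfl <;> norm_num
  obtain ⟨a, ha⟩ : ∃ a, a * δ1 = 1 := ⟨δ1⁻¹, inv_mul_cancel₀ hδ1⟩
  obtain ⟨q, hq⟩ : ∃ q, q * (δ3 ^ 2 + δ4 ^ 2) = 1 := ⟨_, inv_mul_cancel₀ hN⟩
  have hdiv : ∀ z, z / δ1 = z * a := fun z => by rw [eq_inv_of_mul_eq_one_left ha, div_eq_mul_inv]
  have hΔ : (δ3 ^ 2 + δ4 ^ 2) / δ1 ^ 2 = (δ3 ^ 2 + δ4 ^ 2) * a ^ 2 := by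
    rw [eq_inv_of_mul_eq_one_left ha, div_eq_mul_inv, inv_pow]
  simp only [hdiv, hΔ] at hut hvt hht hbt
  set D := (δ3 ^ 2 + δ4 ^ 2) * a ^ 2
  let a₀ := -a * δ2
  let c₁ := q * δ3
  let c₂ := q * δ4
  let c₀ := -q * (δ3 * δ5 + δ4 * δ6)
  let d₁ := -ε * q * δ4
  let d₂ := ε * q * δ3
  let d₀ := ε * q * (δ4 * δ5 - δ3 * δ6)
  have eT : ∀ T, δ1 * (a * T + a₀) + δ2 = T := fun T => by
    simp only [a₀]
    linear_combination (T - δ2) * ha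
  have eX : ∀ X Y, δ3 * (c₁ * X + c₂ * Y + c₀) - ε * δ4 * (d₁ * X + d₂ * Y + d₀) + δ5 = X := by
    intro X Y
    simp only [c₁, c₂, c₀, d₁, d₂, d₀]
    linear_combination (X - δ5) * hq
      + q * δ4 * (δ4 * (X - δ5) - δ3 * (Y - δ6)) * hεε
  have eY : ∀ X Y, δ4 * (c₁ * X + c₂ * Y + c₀) + ε * δ3 * (d₁ * X + d₂ * Y + d₀) + δ6 = Y := by
    intro X Y
    simp only [c₁, c₂, c₀, d₁, d₂, d₀]
    linear_combination (Y - δ6) * hq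
      - q * δ3 * (δ4 * (X - δ5) - δ3 * (Y - δ6)) * hεε
  obtain rfl : ut = fun T X Y =>
      (δ3 * u (a * T + a₀) (c₁ * X + c₂ * Y + c₀) (d₁ * X + d₂ * Y + d₀)
        - ε * δ4 * v (a * T + a₀) (c₁ * X + c₂ * Y + c₀) (d₁ * X + d₂ * Y + d₀)) * a := by
    funext T X Y
    rw [← hut, eT, eX, eY]
  obtain rfl : vt = fun T X Y =>
      (δ4 * u (a * T + a₀) (c₁ * X + c₂ * Y + c₀) (d₁ * X + d₂ * Y + d₀)
        + ε * δ3 * v (a * T + a₀) (c₁ * X + c₂ * Y + c₀) (d₁ * X + d₂ * Y + d₀)) * a := by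
    funext T X Y
    rw [← hvt, eT, eX, eY]
  obtain rfl : ht = fun T X Y =>
      D * h (a * T + a₀) (c₁ * X + c₂ * Y + c₀) (d₁ * X + d₂ * Y + d₀) := by
    funext T X Y
    rw [← hht, eT, eX, eY]
  obtain rfl : bt = fun X Y => D * b (c₁ * X + c₂ * Y + c₀) (d₁ * X + d₂ * Y + d₀) + δ7 := by
    funext X Y
    rw [← hbt, eX, eY]
  clear hut hvt hht hbt
  obtain ⟨sb, su, sv, sh, hpde⟩ := hsol
  rw [univ_prod_univ, contDiffOn_univ] at su sv sh
  rw [contDiffOn_univ] at sb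
  have smooth : ∀ {f : ℝ → ℝ → ℝ → ℝ},
      ContDiff ℝ (⊤ : ℕ∞) (fun p : ℝ × ℝ × ℝ => f p.1 p.2.1 p.2.2) →
      ContDiff ℝ (⊤ : ℕ∞) (fun p : ℝ × ℝ × ℝ => f (a * p.1 + a₀)
        (c₁ * p.2.1 + c₂ * p.2.2 + c₀) (d₁ * p.2.1 + d₂ * p.2.2 + d₀)) := fun hf =>
    hf.comp (f := fun p : ℝ × ℝ × ℝ => (a * p.1 + a₀,
      c₁ * p.2.1 + c₂ * p.2.2 + c₀, d₁ * p.2.1 + d₂ * p.2.2 + d₀)) (by fun_prop)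
  have sb' : ContDiff ℝ (⊤ : ℕ∞) (fun p : ℝ × ℝ =>
      b (c₁ * p.1 + c₂ * p.2 + c₀) (d₁ * p.1 + d₂ * p.2 + d₀)) :=
    sb.comp (f := fun p : ℝ × ℝ =>
      (c₁ * p.1 + c₂ * p.2 + c₀, d₁ * p.1 + d₂ * p.2 + d₀)) (by fun_prop)
  have su' := smooth su
  have sv' := smooth sv
  have sh' := smooth sh
  refine ⟨?_, ?_, ?_, ?_, ?_⟩
  · rw [contDiffOn_univ]
    fun_prop
  · rw [univ_prod_univ, contDiffOn_univ]
    fun_prop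
  · rw [univ_prod_univ, contDiffOn_univ]
    fun_prop
  · rw [univ_prod_univ, contDiffOn_univ]
    fun_prop
  have du := su.differentiable (by simp)
  have dv := sv.differentiable (by simp)
  have dh := sh.differentiable (by simp)
  have db : Differentiable ℝ (fun p : ℝ × ℝ × ℝ => (fun _ x y => b x y : ℝ → ℝ → ℝ → ℝ)
      p.1 p.2.1 p.2.2) :=
    (sb.differentiable (by simp)).comp (differentiable_snd (𝕜 := ℝ) (E := ℝ) (F := ℝ × ℝ))
  intro T X Y _ _
  obtain ⟨ut, ux, uy⟩ := hasDerivAt_affine_change du a a₀ c₁ c₂ c₀ d₁ d₂ d₀ T X Y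
  obtain ⟨vt, vx, vy⟩ := hasDerivAt_affine_change dv a a₀ c₁ c₂ c₀ d₁ d₂ d₀ T X Y
  obtain ⟨ht, hx, hy⟩ := hasDerivAt_affine_change dh a a₀ c₁ c₂ c₀ d₁ d₂ d₀ T X Y
  obtain ⟨-, bx, bY⟩ := hasDerivAt_affine_change (f := fun _ => b) db
    a a₀ c₁ c₂ c₀ d₁ d₂ d₀ T X Y
  obtain ⟨e1, e2, e3⟩ := hpde (a * T + a₀) (c₁ * X + c₂ * Y + c₀) (d₁ * X + d₂ * Y + d₀)
    (mem_univ _) (mem_univ _)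
  set P := a * T + a₀
  set Q := c₁ * X + c₂ * Y + c₀
  set R := d₁ * X + d₂ * Y + d₀
  have pux : pdx (fun t x y => u t x y * h t x y) P Q R
      = pdx u P Q R * h P Q R + u P Q R * pdx h P Q R := by
    refine HasDerivAt.deriv (HasDerivAt.mul ?_ ?_)
    · simpa using (hasDerivAt_comp_curve du (hasDerivAt_const Q P) (hasDerivAt_id' Q)
        (hasDerivAt_const Q R))
    · simpa using (hasDerivAt_comp_curve dh (hasDerivAt_const Q P) (hasDerivAt_id' Q)
        (hasDerivAt_const Q R))
  have pvy : pdy (fun t x y => v t x y * h t x y) P Q R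
      = pdy v P Q R * h P Q R + v P Q R * pdy h P Q R := by
    refine HasDerivAt.deriv (HasDerivAt.mul ?_ ?_)
    · simpa using (hasDerivAt_comp_curve dv (hasDerivAt_const R P) (hasDerivAt_const R Q)
        (hasDerivAt_id' R))
    · simpa using (hasDerivAt_comp_curve dh (hasDerivAt_const R P) (hasDerivAt_const R Q)
        (hasDerivAt_id' R))
  rw [pux, pvy] at e3
  have Ut := ((ut.const_mul δ3).sub (vt.const_mul (ε * δ4))).mul_const a
  have Ux := ((ux.const_mul δ3).sub (vx.const_mul (ε * δ4))).mul_const a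
  have Uy := ((uy.const_mul δ3).sub (vy.const_mul (ε * δ4))).mul_const a
  have Vt := ((ut.const_mul δ4).add (vt.const_mul (ε * δ3))).mul_const a
  have Vx := ((ux.const_mul δ4).add (vx.const_mul (ε * δ3))).mul_const a
  have Vy := ((uy.const_mul δ4).add (vy.const_mul (ε * δ3))).mul_const a
  have Ht := ht.const_mul D
  have Hx := hx.const_mul D
  have Hy := hy.const_mul D
  have Bx : HasDerivAt _ (D * (c₁ * pbx b Q R + d₁ * pby b Q R)) X :=
    (bx.const_mul D).add_const δ7
  have By : HasDerivAt _ (D * (c₂ * pbx b Q R + d₂ * pby b Q R)) Y :=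
    (bY.const_mul D).add_const δ7
  refine ⟨?_, ?_, ?_⟩
  · refine (congrArg₂ (· + ·) (congrArg₂ (· + ·) (congrArg₂ (· + ·) Ut.deriv
      (congrArg₂ (· * ·) rfl Ux.deriv)) (congrArg₂ (· * ·) rfl Uy.deriv)) Hx.deriv).trans
      (Eq.trans ?_ Bx.deriv.symm)
    simp only [D, c₁, c₂, d₁, d₂]
    linear_combination a ^ 2 * (δ3 * e1 - ε * δ4 * e2)
      + a ^ 2 * (u P Q R * (δ3 * pdx u P Q R - ε * δ4 * pdx v P Q R)
        + ε ^ 2 * v P Q R * (δ3 * pdy u P Q R - ε * δ4 * pdy v P Q R)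
        + δ3 * (pdx h P Q R - pbx b Q R) - ε * δ4 * (pdy h P Q R - pby b Q R)) * hq
      + a ^ 2 * v P Q R * (δ3 * pdy u P Q R - ε * δ4 * pdy v P Q R) * hεε
  · refine (congrArg₂ (· + ·) (congrArg₂ (· + ·) (congrArg₂ (· + ·) Vt.deriv
      (congrArg₂ (· * ·) rfl Vx.deriv)) (congrArg₂ (· * ·) rfl Vy.deriv)) Hy.deriv).trans
      (Eq.trans ?_ By.deriv.symm)
    simp only [D, c₁, c₂, d₁, d₂]
    linear_combination a ^ 2 * (δ4 * e1 + ε * δ3 * e2)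
      + a ^ 2 * (u P Q R * (δ4 * pdx u P Q R + ε * δ3 * pdx v P Q R)
        + ε ^ 2 * v P Q R * (δ4 * pdy u P Q R + ε * δ3 * pdy v P Q R)
        + δ4 * (pdx h P Q R - pbx b Q R) + ε * δ3 * (pdy h P Q R - pby b Q R)) * hq
      + a ^ 2 * v P Q R * (δ4 * pdy u P Q R + ε * δ3 * pdy v P Q R) * hεε
  · refine (congrArg₂ (· + ·) (congrArg₂ (· + ·) Ht.deriv
      (Ux.mul Hx).deriv) (Vy.mul Hy).deriv).trans ?_
    change D * (a * pdt h P Q R)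
      + ((δ3 * (c₁ * pdx u P Q R + d₁ * pdy u P Q R)
          - ε * δ4 * (c₁ * pdx v P Q R + d₁ * pdy v P Q R)) * a * (D * h P Q R)
        + (δ3 * u P Q R - ε * δ4 * v P Q R) * a * (D * (c₁ * pdx h P Q R + d₁ * pdy h P Q R)))
      + ((δ4 * (c₂ * pdx u P Q R + d₂ * pdy u P Q R)
          + ε * δ3 * (c₂ * pdx v P Q R + d₂ * pdy v P Q R)) * a * (D * h P Q R)
        + (δ4 * u P Q R + ε * δ3 * v P Q R) * a * (D * (c₂ * pdx h P Q R + d₂ * pdy h P Q R))) = 0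
    simp only [D, c₁, c₂, d₁, d₂]
    linear_combination D * a * e3
      + D * a * (u P Q R * pdx h P Q R + h P Q R * pdx u P Q R
        + ε ^ 2 * (v P Q R * pdy h P Q R + h P Q R * pdy v P Q R)) * hq
      + D * a * (v P Q R * pdy h P Q R + h P Q R * pdy v P Q R) * hεε
end
end

section
/- Let F¹, F², F³, F⁴ : ℝ → ℝ be smooth functions and c₁, c₂ ∈ ℝ. Suppose that for every smooth function b : ℝ² → ℝ and all (t,x,y) ∈ ℝ³ the classifying equation (F¹′(t)x + c₂y + F²(t))·b_x(x,y) + (−c₂x + F¹′(t)y + F³(t))·b_y(x,y) + 2(F¹′(t) − c₁)·b(x,y) − F¹‴(t)(x² + y²)/2 − F²″(t)x − F³″(t)y − F⁴(t) = 0 holds. Then F¹ is constant, F² = F³ = F⁴ = 0 identically, and c₁ = c₂ = 0. (Consequently the kernel Lie invariance algebra of the class of shallow water systems is the one-dimensional algebra spanned by ∂_t.) -/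
noncomputable section

open Real Set

/-- if the classifying equation holds for every smooth bottom topography `b`,
then `F¹` is constant, `F² = F³ = F⁴ = 0` and `c₁ = c₂ = 0`; hence the kernel Lie invariance
algebra of the class of shallow water systems is spanned by `∂_t`. -/
theorem stmt_1 (F1 F2 F3 F4 : ℝ → ℝ) (c1 c2 : ℝ)
    (hF1 : ContDiff ℝ (⊤ : ℕ∞) F1) (hF2 : ContDiff ℝ (⊤ : ℕ∞) F2)
    (hF3 : ContDiff ℝ (⊤ : ℕ∞) F3) (hF4 : ContDiff ℝ (⊤ : ℕ∞) F4)
    (hcl : ∀ b : ℝ → ℝ → ℝ, ContDiff ℝ (⊤ : ℕ∞) (fun p : ℝ × ℝ => b p.1 p.2) → ∀ t x y : ℝ,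
      (deriv F1 t * x + c2 * y + F2 t) * pbx b x y
        + (-(c2 * x) + deriv F1 t * y + F3 t) * pby b x y
        + 2 * (deriv F1 t - c1) * b x y
        - deriv (deriv (deriv F1)) t * (x ^ 2 + y ^ 2) / 2
        - deriv (deriv F2) t * x - deriv (deriv F3) t * y - F4 t = 0) :
    (∀ t s : ℝ, F1 t = F1 s) ∧ (∀ t, F2 t = 0) ∧ (∀ t, F3 t = 0) ∧ (∀ t, F4 t = 0)
      ∧ c1 = 0 ∧ c2 = 0 := by
  have h0 := hcl (fun _ _ => 0) contDiff_const
  have h1 := hcl (fun _ _ => 1) contDiff_const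
  have hx := hcl (fun x _ => x) contDiff_fst
  have hy := hcl (fun _ y => y) contDiff_snd
  simp only [pbx, pby, deriv_const, deriv_id''] at h0 h1 hx hy
  have hF1' : ∀ t, deriv F1 t = c1 := fun t => by
    linarith [h0 t 0 0, h1 t 0 0]
  simp only [hF1'] at h0 hx hy
  have hA : ∀ t x y : ℝ, c1 * x + c2 * y + F2 t = 0 := fun t x y => by
    linarith [h0 t x y, hx t x y]
  have hB : ∀ t x y : ℝ, -(c2 * x) + c1 * y + F3 t = 0 := fun t x y => by
    linarith [h0 t x y, hy t x y]
  have hc1 : c1 = 0 := by linarith [hA 0 0 0, hA 0 1 0]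
  have hc2 : c2 = 0 := by linarith [hA 0 0 0, hA 0 0 1]
  refine ⟨?_, fun t => by linarith [hA t 0 0], fun t => by linarith [hB t 0 0],
    fun t => by linarith [h0 t 0 0], hc1, hc2⟩
  exact is_const_of_deriv_eq_zero (hF1.differentiable (by simp)) fun t => (hF1' t).trans hc1
end
end

section
/- On ℝ³ with coordinates (x,y,b), let 𝔞 be the real span of the nine vector fields x∂_x + y∂_y, −x∂_y + y∂_x, ∂_x, ∂_y, b∂_b, (x² + y²)∂_b, x∂_b, y∂_b, ∂_b. Then 𝔞 is closed under the Lie bracket of vector fields (hence it is a Lie algebra), and its derived algebra [𝔞,𝔞] equals the span of the six vector fields ∂_x, ∂_y, (x² + y²)∂_b, x∂_b, y∂_b, ∂_b. -/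
noncomputable section

open Real Set

/-- The Lie bracket of vector fields on ℝ³ (identified with smooth maps),
`[X,Y](p) = DY(p)·X(p) − DX(p)·Y(p)`. -/
def lieVF (X Y : (Fin 3 → ℝ) → (Fin 3 → ℝ)) : (Fin 3 → ℝ) → (Fin 3 → ℝ) :=
  fun p => fderiv ℝ Y p (X p) - fderiv ℝ X p (Y p)

/-- The nine generating vector fields on ℝ³ with coordinates `(x,y,b)`:
`x∂_x + y∂_y`, `−x∂_y + y∂_x`, `∂_x`, `∂_y`, `b∂_b`, `(x²+y²)∂_b`, `x∂_b`, `y∂_b`, `∂_b`. -/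
def A1 : (Fin 3 → ℝ) → (Fin 3 → ℝ) := fun p => ![p 0, p 1, 0]
def A2 : (Fin 3 → ℝ) → (Fin 3 → ℝ) := fun p => ![p 1, -(p 0), 0]
def A3 : (Fin 3 → ℝ) → (Fin 3 → ℝ) := fun _ => ![1, 0, 0]
def A4 : (Fin 3 → ℝ) → (Fin 3 → ℝ) := fun _ => ![0, 1, 0]
def A5 : (Fin 3 → ℝ) → (Fin 3 → ℝ) := fun p => ![0, 0, p 2]
def A6 : (Fin 3 → ℝ) → (Fin 3 → ℝ) := fun p => ![0, 0, (p 0) ^ 2 + (p 1) ^ 2]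
def A7 : (Fin 3 → ℝ) → (Fin 3 → ℝ) := fun p => ![0, 0, p 0]
def A8 : (Fin 3 → ℝ) → (Fin 3 → ℝ) := fun p => ![0, 0, p 1]
def A9 : (Fin 3 → ℝ) → (Fin 3 → ℝ) := fun _ => ![0, 0, 1]

/-- The span 𝔞 of the nine vector fields. -/
def aAlg : Submodule ℝ ((Fin 3 → ℝ) → (Fin 3 → ℝ)) :=
  Submodule.span ℝ {A1, A2, A3, A4, A5, A6, A7, A8, A9}

/-- The linear combination of the nine generating vector fields with coefficients `c`. -/
def generatorComb (c : Fin 9 → ℝ) : (Fin 3 → ℝ) → (Fin 3 → ℝ) := fun p =>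
  ![c 0 * p 0 + c 1 * p 1 + c 2, c 0 * p 1 - c 1 * p 0 + c 3,
    c 4 * p 2 + c 5 * ((p 0) ^ 2 + (p 1) ^ 2) + c 6 * p 0 + c 7 * p 1 + c 8]

lemma generatorComb_eq (c : Fin 9 → ℝ) :
    generatorComb c = c 0 • A1 + (c 1 • A2 + (c 2 • A3 + (c 3 • A4 + (c 4 • A5 + (c 5 • A6 +
      (c 6 • A7 + (c 7 • A8 + c 8 • A9))))))) := by
  ext p i
  fin_cases i <;> simp [generatorComb, A1, A2, A3, A4, A5, A6, A7, A8, A9] <;> ring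

lemma mem_aAlg_iff {X : (Fin 3 → ℝ) → (Fin 3 → ℝ)} :
    X ∈ aAlg ↔ ∃ c, X = generatorComb c := by
  constructor
  · intro h
    simp only [aAlg, Submodule.mem_span_insert, Submodule.mem_span_singleton] at h
    obtain ⟨c0, _, ⟨c1, _, ⟨c2, _, ⟨c3, _, ⟨c4, _, ⟨c5, _, ⟨c6, _, ⟨c7, _, ⟨c8, rfl⟩, rfl⟩, rfl⟩,
      rfl⟩, rfl⟩, rfl⟩, rfl⟩, rfl⟩, rfl⟩ := h
    exact ⟨![c0, c1, c2, c3, c4, c5, c6, c7, c8], (generatorComb_eq ![c0, c1, c2, c3, c4, c5, c6, c7, c8]).symm⟩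
  · rintro ⟨c, rfl⟩
    rw [generatorComb_eq]
    simp only [aAlg, Submodule.mem_span_insert, Submodule.mem_span_singleton]
    exact ⟨_, _, ⟨_, _, ⟨_, _, ⟨_, _, ⟨_, _, ⟨_, _, ⟨_, _, ⟨_, _, ⟨_, rfl⟩, rfl⟩, rfl⟩, rfl⟩, rfl⟩,
      rfl⟩, rfl⟩, rfl⟩, rfl⟩

lemma generatorComb_mem_span {c : Fin 9 → ℝ} (h0 : c 0 = 0) (h1 : c 1 = 0) (h4 : c 4 = 0) :
    generatorComb c ∈ Submodule.span ℝ {A3, A4, A6, A7, A8, A9} := by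
  simp only [generatorComb_eq, h0, h1, h4, zero_smul, zero_add, Submodule.mem_span_insert,
    Submodule.mem_span_singleton]
  exact ⟨_, _, ⟨_, _, ⟨_, _, ⟨_, _, ⟨_, _, ⟨_, rfl⟩, rfl⟩, rfl⟩, rfl⟩, rfl⟩, rfl⟩

lemma fderiv_generatorComb (c : Fin 9 → ℝ) (p v : Fin 3 → ℝ) :
    fderiv ℝ (generatorComb c) p v =
      ![c 0 * v 0 + c 1 * v 1, c 0 * v 1 - c 1 * v 0,
        c 4 * v 2 + c 5 * (2 * p 0 * v 0 + 2 * p 1 * v 1) + c 6 * v 0 + c 7 * v 1] := by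
  have hp (i : Fin 3) : HasFDerivAt (fun q : Fin 3 → ℝ => q i)
      (ContinuousLinearMap.proj (R := ℝ) (φ := fun _ : Fin 3 => ℝ) i) p := hasFDerivAt_apply i p
  have h0 := (((hp 0).const_mul (c 0)).add ((hp 1).const_mul (c 1))).add_const (c 2)
  have h1 := (((hp 1).const_mul (c 0)).sub ((hp 0).const_mul (c 1))).add_const (c 3)
  have h2 := (((((hp 2).const_mul (c 4)).add
    ((((hp 0).pow 2).add ((hp 1).pow 2)).const_mul (c 5))).add
    ((hp 0).const_mul (c 6))).add ((hp 1).const_mul (c 7))).add_const (c 8)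
  have hd : DifferentiableAt ℝ (generatorComb c) p := by
    refine differentiableAt_pi.2 fun i => ?_
    fin_cases i
    exacts [h0.differentiableAt, h1.differentiableAt, h2.differentiableAt]
  have hc := hasFDerivAt_pi'.1 hd.hasFDerivAt
  ext i
  fin_cases i
  · simpa using DFunLike.congr_fun ((hc 0).unique h0) v
  · simpa using DFunLike.congr_fun ((hc 1).unique h1) v
  · simpa [mul_add] using DFunLike.congr_fun ((hc 2).unique h2) v

lemma lieVF_generatorComb (c d : Fin 9 → ℝ) :
    lieVF (generatorComb c) (generatorComb d) = generatorComb
      ![0, 0, d 0 * c 2 + d 1 * c 3 - c 0 * d 2 - c 1 * d 3,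
        d 0 * c 3 - d 1 * c 2 - c 0 * d 3 + c 1 * d 2, 0,
        d 4 * c 5 - c 4 * d 5 + 2 * (d 5 * c 0 - c 5 * d 0),
        d 4 * c 6 - c 4 * d 6 + 2 * (d 5 * c 2 - c 5 * d 2) + d 6 * c 0 - d 7 * c 1
          - c 6 * d 0 + c 7 * d 1,
        d 4 * c 7 - c 4 * d 7 + 2 * (d 5 * c 3 - c 5 * d 3) + d 6 * c 1 + d 7 * c 0
          - c 6 * d 1 - c 7 * d 0,
        d 4 * c 8 - c 4 * d 8 + d 6 * c 2 + d 7 * c 3 - c 6 * d 2 - c 7 * d 3] := by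
  ext p i
  simp only [lieVF, fderiv_generatorComb]
  fin_cases i <;> simp [generatorComb] <;> ring

/-- 𝔞 is closed under the Lie bracket of vector fields (hence is a Lie
algebra), and its derived algebra `[𝔞,𝔞]` equals the span of
`∂_x, ∂_y, (x²+y²)∂_b, x∂_b, y∂_b, ∂_b`. -/
theorem stmt_3 :
    (∀ X ∈ aAlg, ∀ Y ∈ aAlg, lieVF X Y ∈ aAlg) ∧
    Submodule.span ℝ {Z | ∃ X ∈ aAlg, ∃ Y ∈ aAlg, Z = lieVF X Y}
      = Submodule.span ℝ {A3, A4, A6, A7, A8, A9} := by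
  refine ⟨fun X hX Y hY => ?_, le_antisymm (Submodule.span_le.2 ?_) (Submodule.span_le.2 ?_)⟩
  · obtain ⟨c, rfl⟩ := mem_aAlg_iff.1 hX
    obtain ⟨d, rfl⟩ := mem_aAlg_iff.1 hY
    exact mem_aAlg_iff.2 ⟨_, lieVF_generatorComb c d⟩
  · rintro _ ⟨X, hX, Y, hY, rfl⟩
    obtain ⟨c, rfl⟩ := mem_aAlg_iff.1 hX
    obtain ⟨d, rfl⟩ := mem_aAlg_iff.1 hY
    rw [SetLike.mem_coe, lieVF_generatorComb]
    exact generatorComb_mem_span rfl rfl rfl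
  · have key (c d : Fin 9 → ℝ) := Submodule.subset_span (R := ℝ)
      (s := {Z | ∃ X ∈ aAlg, ∃ Y ∈ aAlg, Z = lieVF X Y})
      ⟨_, mem_aAlg_iff.2 ⟨c, rfl⟩, _, mem_aAlg_iff.2 ⟨d, rfl⟩, (lieVF_generatorComb c d).symm⟩
    rintro _ (rfl | rfl | rfl | rfl | rfl | rfl)
    · simpa [generatorComb_eq] using key (Pi.single 2 1) (Pi.single 0 1)
    · simpa [generatorComb_eq] using key (Pi.single 3 1) (Pi.single 0 1)
    · simpa [generatorComb_eq] using key (Pi.single 5 1) (Pi.single 4 1)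
    · simpa [generatorComb_eq] using key (Pi.single 6 1) (Pi.single 4 1)
    · simpa [generatorComb_eq] using key (Pi.single 7 1) (Pi.single 4 1)
    · simpa [generatorComb_eq] using key (Pi.single 8 1) (Pi.single 4 1)
end
end

section
/- Let 𝔤 be the 7-dimensional real Lie algebra with basis e₁,…,e₇ whose nonzero commutation relations (up to antisymmetry) are [e₂,e₅] = e₂, [e₃,e₅] = e₃, [e₄,e₅] = 2e₄, [e₁,e₆] = e₁, [e₄,e₆] = −2e₄, [e₂,e₇] = e₃, [e₃,e₇] = −e₂. A linear map L : 𝔤 → 𝔤 is a Lie algebra automorphism of 𝔤 if and only if the matrix A of L in the basis (e₁,…,e₇) (with L e_j = Σ_i A_{ij} e_i) has the form: row 1 = (a¹₁, 0, 0, 0, 0, a¹₆, 0); row 2 = (0, a²₂, −ε a³₂, 0, a²₅, 0, a²₇); row 3 = (0, a³₂, ε a²₂, 0, −ε a²₇, 0, ε a²₅); row 4 = (0, 0, 0, a⁴₄, −a⁴₆, a⁴₆, 0); row 5 = (0, 0, 0, 0, 1, 0, 0); row 6 = (0, 0, 0, 0, 0, 1, 0); row 7 = (0, 0, 0, 0,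 0, 0, ε), for some ε ∈ {−1,1} and real parameters a¹₁, a¹₆, a²₂, a³₂, a²₅, a²₇, a⁴₄, a⁴₆ satisfying a¹₁·((a²₂)² + (a³₂)²)·a⁴₄ ≠ 0. -/
noncomputable section

open Real

/-- The bracket of the 7-dimensional Lie algebra 𝔤 with basis `e₁,…,e₇` (here indexed
`0,…,6`) and nonzero commutation relations `[e₂,e₅] = e₂`, `[e₃,e₅] = e₃`,
`[e₄,e₅] = 2e₄`, `[e₁,e₆] = e₁`, `[e₄,e₆] = −2e₄`, `[e₂,e₇] = e₃`, `[e₃,e₇] = −e₂`,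
extended bilinearly. -/
def br7 (x y : Fin 7 → ℝ) : Fin 7 → ℝ :=
  ![x 0 * y 5 - x 5 * y 0,
    (x 1 * y 4 - x 4 * y 1) - (x 2 * y 6 - x 6 * y 2),
    (x 2 * y 4 - x 4 * y 2) + (x 1 * y 6 - x 6 * y 1),
    2 * (x 3 * y 4 - x 4 * y 3) - 2 * (x 3 * y 5 - x 5 * y 3),
    0, 0, 0]

/-- Columns of a bracket-preserving matrix satisfy the relations of the basis vectors. -/
theorem br7_col_col {A : Matrix (Fin 7) (Fin 7) ℝ}
    (h : ∀ x y : Fin 7 → ℝ, A.mulVec (br7 x y) = br7 (A.mulVec x) (A.mulVec y)) (i j k : Fin 7) :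
    br7 (A.col i) (A.col j) k = A.mulVec (br7 (Pi.single i 1) (Pi.single j 1)) k := by
  rw [h, Matrix.mulVec_single_one, Matrix.mulVec_single_one]

theorem not_forall_eq_zero_of_injective_mulVec {A : Matrix (Fin 7) (Fin 7) ℝ}
    (h : Function.Injective (fun x : Fin 7 → ℝ => A.mulVec x)) (j : Fin 7) :
    ¬ ∀ i, A i j = 0 := by
  intro hj
  have h0 : A.mulVec (Pi.single j 1) = A.mulVec 0 := by
    ext i
    simp [hj i]
  simpa using congrFun (h h0) j

theorem eq_zero_of_rotation_eq_zero {a b p r : ℝ} (hab : a ^ 2 + b ^ 2 ≠ 0)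
    (h₁ : a * p - b * r = 0) (h₂ : b * p + a * r = 0) : p = 0 ∧ r = 0 := by
  have hp : (a ^ 2 + b ^ 2) * p = 0 := by linear_combination a * h₁ + b * h₂
  have hr : (a ^ 2 + b ^ 2) * r = 0 := by linear_combination a * h₂ - b * h₁
  exact ⟨(mul_eq_zero.mp hp).resolve_left hab, (mul_eq_zero.mp hr).resolve_left hab⟩

theorem eq_zero_of_mul_eq_of_mul_eq_neg {a b q : ℝ} (h₁ : a * q = b) (h₂ : b * q = -a) :
    a = 0 ∧ b = 0 := by
  have ha : a * (q ^ 2 + 1) = 0 := by linear_combination q * h₁ + h₂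
  have ha' : a = 0 := (mul_eq_zero.mp ha).resolve_right (by positivity)
  exact ⟨ha', by rw [← h₁, ha', zero_mul]⟩

/-- The general form of the matrix of an automorphism. -/
def br7AutMatrix (ε a11 a16 a22 a32 a25 a27 a44 a46 : ℝ) : Matrix (Fin 7) (Fin 7) ℝ :=
  Matrix.of
    ![![a11, 0, 0, 0, 0, a16, 0],
      ![0, a22, -(ε * a32), 0, a25, 0, a27],
      ![0, a32, ε * a22, 0, -(ε * a27), 0, ε * a25],
      ![0, 0, 0, a44, -a46, a46, 0],
      ![0, 0, 0, 0, 1, 0, 0],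
      ![0, 0, 0, 0, 0, 1, 0],
      ![0, 0, 0, 0, 0, 0, ε]]

set_option maxHeartbeats 1000000 in
theorem exists_eq_br7AutMatrix {A : Matrix (Fin 7) (Fin 7) ℝ}
    (hinj : Function.Injective (fun x : Fin 7 → ℝ => A.mulVec x))
    (hbr : ∀ x y : Fin 7 → ℝ, A.mulVec (br7 x y) = br7 (A.mulVec x) (A.mulVec y)) :
    ∃ ε a11 a16 a22 a32 a25 a27 a44 a46 : ℝ, (ε = 1 ∨ ε = -1) ∧
      a11 * (a22 ^ 2 + a32 ^ 2) * a44 ≠ 0 ∧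
      A = br7AutMatrix ε a11 a16 a22 a32 a25 a27 a44 a46 := by
  have hcol := not_forall_eq_zero_of_injective_mulVec hinj
  have E (i j k) := br7_col_col hbr i j k
  have e₀₄ := E 0 4
  have e₀₅ := E 0 5
  have e₀₆ := E 0 6
  have e₁₄ := E 1 4
  have e₁₅ := E 1 5
  have e₁₆ := E 1 6
  have e₂₆ := E 2 6
  have e₃₄ := E 3 4
  have e₃₅ := E 3 5
  have e₄₅ := E 4 5
  have e₄₆ := E 4 6
  have e₅₆ := E 5 6
  simp [Fin.forall_fin_succ, br7, Matrix.mulVec, dotProduct, Fin.sum_univ_succ, Matrix.col]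
    at e₀₄ e₀₅ e₀₆ e₁₄ e₁₅ e₁₆ e₂₆ e₃₄ e₃₅ e₄₅ e₄₆ e₅₆
  -- The derived algebra, spanned by the first four basis vectors, is preserved.
  have z₀ : A 4 0 = 0 ∧ A 5 0 = 0 ∧ A 6 0 = 0 := by simp [← e₀₅.2.2.2.2]
  have z₁ : A 4 1 = 0 ∧ A 5 1 = 0 ∧ A 6 1 = 0 := e₂₆.2.2.2.2
  have z₂ : A 4 2 = 0 ∧ A 5 2 = 0 ∧ A 6 2 = 0 := by simp [← e₁₆.2.2.2.2]
  have z₃ : A 4 3 = 0 ∧ A 5 3 = 0 ∧ A 6 3 = 0 := e₃₄.2.2.2.2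
  simp only [z₀, z₁, z₂, z₃, zero_mul, sub_zero] at e₀₄ e₀₅ e₀₆ e₁₄ e₁₅ e₁₆ e₂₆ e₃₄ e₃₅
  obtain ⟨h₀₁, h₀₂⟩ := eq_zero_of_mul_eq_of_mul_eq_neg e₁₆.1 e₂₆.1
  obtain ⟨h₃₁, h₃₂⟩ := eq_zero_of_mul_eq_of_mul_eq_neg (a := A 3 1) (b := A 3 2)
    (q := 2 * A 4 6 - 2 * A 5 6) (by linear_combination e₁₆.2.2.2.1)
    (by linear_combination e₂₆.2.2.2.1)
  -- The images of the second and third basis vectors determine rows five and seven.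
  have hw : A 1 1 ^ 2 + A 2 1 ^ 2 ≠ 0 := by
    intro h
    have h₁₁ : A 1 1 = 0 :=
      pow_eq_zero_iff two_ne_zero |>.mp (by nlinarith only [h, sq_nonneg (A 1 1), sq_nonneg (A 2 1)])
    have h₂₁ : A 2 1 = 0 :=
      pow_eq_zero_iff two_ne_zero |>.mp (by nlinarith only [h, sq_nonneg (A 1 1), sq_nonneg (A 2 1)])
    exact hcol 1 (by simp [Fin.forall_fin_succ, z₁, h₀₁, h₁₁, h₂₁, h₃₁])
  obtain ⟨h₄₄, h₆₄⟩ := eq_zero_of_rotation_eq_zero hw (p := A 4 4 - 1) (r := A 6 4)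
    (by linear_combination e₁₄.2.1) (by linear_combination e₁₄.2.2.1)
  obtain ⟨h₄₅, h₆₅⟩ := eq_zero_of_rotation_eq_zero hw e₁₅.2.1 e₁₅.2.2.1
  obtain ⟨hre, him⟩ := eq_zero_of_rotation_eq_zero hw
    (p := A 4 6 ^ 2 - A 6 6 ^ 2 + 1) (r := 2 * A 4 6 * A 6 6)
    (by linear_combination e₂₆.2.1 + A 4 6 * e₁₆.2.1 - A 6 6 * e₁₆.2.2.1)
    (by linear_combination e₂₆.2.2.1 + A 4 6 * e₁₆.2.2.1 + A 6 6 * e₁₆.2.1)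
  have h₄₄ : A 4 4 = 1 := sub_eq_zero.mp h₄₄
  have h₆₆ : A 6 6 ≠ 0 := by
    intro h
    nlinarith only [h, hre, sq_nonneg (A 4 6)]
  have h₄₆ : A 4 6 = 0 := by simpa [h₆₆] using him
  have hε : A 6 6 = 1 ∨ A 6 6 = -1 := by
    apply sq_eq_one_iff.mp
    linear_combination -hre + A 4 6 * h₄₆
  simp only [h₄₄, h₄₅, h₄₆, h₆₄, h₆₅, mul_zero, mul_one, sub_zero, add_zero, zero_sub, zero_mul,
    zero_add] at e₀₄ e₀₅ e₀₆ e₁₆ e₃₄ e₃₅ e₄₅ e₄₆ e₅₆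
  have h₁₀ : A 1 0 = 0 := e₀₄.2.1
  have h₂₀ : A 2 0 = 0 := e₀₄.2.2.1
  have h₁₃ : A 1 3 = 0 := by linarith only [e₃₄.2.1]
  have h₂₃ : A 2 3 = 0 := by linarith only [e₃₄.2.2.1]
  -- The images of the first and fourth basis vectors determine row six.
  have h₀₀ : A 0 0 ≠ 0 := by
    intro h
    have h₃₀ : A 3 0 ≠ 0 := by
      intro h'
      exact hcol 0 (by simp [Fin.forall_fin_succ, z₀, h, h₁₀, h₂₀, h'])
    have h₅₅ : A 5 5 = -1 / 2 := by
      apply mul_left_cancel₀ h₃₀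
      linear_combination -1 / 2 * e₀₅.2.2.2.1
    rw [h₅₅] at e₃₅
    have h₀₃ : A 0 3 = 0 := by linarith only [e₃₅.1]
    have h₃₃ : A 3 3 = 0 := by linarith only [e₃₅.2.2.2.1]
    exact hcol 3 (by simp [Fin.forall_fin_succ, z₃, h₀₃, h₁₃, h₂₃, h₃₃])
  have h₅₄ : A 5 4 = 0 := (mul_eq_zero.mp e₀₄.1).resolve_left h₀₀
  have h₅₆ : A 5 6 = 0 := (mul_eq_zero.mp e₀₆.1).resolve_left h₀₀
  have h₅₅ : A 5 5 = 1 := mul_left_cancel₀ h₀₀ (by linear_combination e₀₅.1)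
  simp only [h₅₄, h₅₅, h₅₆, mul_zero, mul_one, sub_zero, zero_sub, zero_mul, one_mul]
    at e₀₅ e₃₄ e₃₅ e₄₅ e₅₆
  have h₃₀ : A 3 0 = 0 := by linarith only [e₀₅.2.2.2.1]
  have h₀₃ : A 0 3 = 0 := by linarith only [e₃₅.1]
  have h₃₃ : A 3 3 ≠ 0 := by
    intro h
    exact hcol 3 (by simp [Fin.forall_fin_succ, z₃, h₀₃, h₁₃, h₂₃, h])
  have h₀₄ : A 0 4 = 0 := e₄₅.1
  have h₀₆ : A 0 6 = 0 := by linarith only [e₅₆.1]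
  have h₁₅ : A 1 5 = 0 := by linarith only [e₄₅.2.1]
  have h₂₅ : A 2 5 = 0 := by linarith only [e₄₅.2.2.1]
  have h₃₄ : A 3 4 = -A 3 5 := by linarith only [e₄₅.2.2.2]
  have h₃₆ : A 3 6 = 0 := by linarith only [e₅₆.2.2.2]
  have h₁₂ : A 1 2 = -(A 6 6 * A 2 1) := by linarith only [e₁₆.2.1]
  have h₂₂ : A 2 2 = A 6 6 * A 1 1 := by linarith only [e₁₆.2.2.1]
  have h₂₆ : A 2 6 = A 6 6 * A 1 4 := by linarith only [e₄₆.2.2.1]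
  have hsq : A 6 6 * A 6 6 = 1 := by rcases hε with h | h <;> simp [h]
  have h₂₄ : A 2 4 = -(A 6 6 * A 1 6) := by
    linear_combination (-A 2 4) * hsq - A 6 6 * e₄₆.2.1
  refine ⟨A 6 6, A 0 0, A 0 5, A 1 1, A 2 1, A 1 4, A 1 6, A 3 3, A 3 5, hε,
    mul_ne_zero (mul_ne_zero h₀₀ hw) h₃₃, ?_⟩
  ext i j
  fin_cases i <;> fin_cases j <;> first | rfl |
    simp [br7AutMatrix, z₀, z₁, z₂, z₃, h₀₁, h₀₂, h₀₃, h₀₄, h₀₆, h₁₀, h₁₂, h₁₃, h₁₅, h₂₀, h₂₂, h₂₃,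
      h₂₄, h₂₅, h₂₆, h₃₀, h₃₁, h₃₂, h₃₄, h₃₆, h₄₄, h₄₅, h₄₆, h₅₄, h₅₅, h₅₆, h₆₄, h₆₅]

theorem br7AutMatrix_mulVec_injective {ε a b c d e f g k : ℝ} (hε : ε ≠ 0)
    (hne : a * (c ^ 2 + d ^ 2) * g ≠ 0) :
    Function.Injective (br7AutMatrix ε a b c d e f g k).mulVec := by
  obtain ⟨⟨ha, hw⟩, hg⟩ : (a ≠ 0 ∧ c ^ 2 + d ^ 2 ≠ 0) ∧ g ≠ 0 := by
    simpa only [mul_ne_zero_iff] using hne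
  refine (injective_iff_map_eq_zero (br7AutMatrix ε a b c d e f g k).mulVecLin).mpr fun x hx => ?_
  simp [br7AutMatrix, funext_iff, Fin.forall_fin_succ, dotProduct,
    Fin.sum_univ_succ, hε] at hx
  obtain ⟨x₀, x₁, x₂, x₃, x₄, x₅, x₆⟩ := hx
  simp only [x₄, x₅, x₆, mul_zero, add_zero] at x₀ x₁ x₂ x₃
  obtain ⟨y₁, y₂⟩ := eq_zero_of_rotation_eq_zero hw (p := x 1) (r := ε * x 2)
    (by linear_combination x₁) (by linear_combination x₂)
  ext i
  fin_cases i <;> simp_all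

theorem br7AutMatrix_mulVec_br7 {ε : ℝ} (a b c d e f g k : ℝ) (hε : ε * ε = 1)
    (x y : Fin 7 → ℝ) :
    (br7AutMatrix ε a b c d e f g k).mulVec (br7 x y) =
      br7 ((br7AutMatrix ε a b c d e f g k).mulVec x)
        ((br7AutMatrix ε a b c d e f g k).mulVec y) := by
  ext i
  fin_cases i <;> simp [br7AutMatrix, br7, Matrix.mulVec, dotProduct, Fin.sum_univ_succ]
  · ring
  · linear_combination (c * (x 2 * y 6 - x 6 * y 2) - f * (x 4 * y 6 - x 6 * y 4)) * hε
  · linear_combination d * (x 2 * y 6 - x 6 * y 2) * hε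
  · ring

/-- a linear map of 𝔤 (given by the matrix `A`, with `L e_j = Σ_i A_{ij} e_i`)
is a Lie algebra automorphism of 𝔤 if and only if `A` has the indicated form. -/
theorem stmt_4 (A : Matrix (Fin 7) (Fin 7) ℝ) :
    (Function.Bijective (fun x : Fin 7 → ℝ => A.mulVec x) ∧
      ∀ x y : Fin 7 → ℝ, A.mulVec (br7 x y) = br7 (A.mulVec x) (A.mulVec y)) ↔
    ∃ ε a11 a16 a22 a32 a25 a27 a44 a46 : ℝ, (ε = 1 ∨ ε = -1) ∧
      a11 * (a22 ^ 2 + a32 ^ 2) * a44 ≠ 0 ∧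
      A = Matrix.of
        ![![a11, 0, 0, 0, 0, a16, 0],
          ![0, a22, -(ε * a32), 0, a25, 0, a27],
          ![0, a32, ε * a22, 0, -(ε * a27), 0, ε * a25],
          ![0, 0, 0, a44, -a46, a46, 0],
          ![0, 0, 0, 0, 1, 0, 0],
          ![0, 0, 0, 0, 0, 1, 0],
          ![0, 0, 0, 0, 0, 0, ε]] := by
  constructor
  · rintro ⟨hbij, hbr⟩
    exact exists_eq_br7AutMatrix hbij.injective hbr
  · rintro ⟨ε, a, b, c, d, e, f, g, k, hε, hne, rfl⟩
    have hsq : ε * ε = 1 := by rcases hε with h | h <;> simp [h]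
    have hinj := br7AutMatrix_mulVec_injective (b := b) (e := e) (f := f) (k := k)
      (left_ne_zero_of_mul_eq_one hsq) hne
    exact ⟨⟨hinj, LinearMap.injective_iff_surjective
      (f := (br7AutMatrix ε a b c d e f g k).mulVecLin).mp hinj⟩,
      br7AutMatrix_mulVec_br7 a b c d e f g k hsq⟩
end
end

section
/- For β ∈ (0,1), let L(β) denote the six-dimensional real Lie algebra with basis e₁,…,e₆ and nonzero commutation relations (up to antisymmetry) [e₁,e₅] = ½(1−β)e₁, [e₂,e₅] = ½(1+β)e₂, [e₄,e₅] = e₄, [e₁,e₆] = ½(1+β)e₁, [e₂,e₆] = ½(1−β)e₂, [e₃,e₆] = e₃. Then for β, β′ ∈ (0,1) with β ≠ β′, the Lie algebras L(β) and L(β′) are not isomorphic. -/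
noncomputable section

open Real

/-- The bracket of the six-dimensional Lie algebra `L(β)` with basis `e₁,…,e₆` (indexed
`0,…,5`) and nonzero commutation relations `[e₁,e₅] = ½(1−β)e₁`, `[e₂,e₅] = ½(1+β)e₂`,
`[e₄,e₅] = e₄`, `[e₁,e₆] = ½(1+β)e₁`, `[e₂,e₆] = ½(1−β)e₂`, `[e₃,e₆] = e₃`, extended
bilinearly. -/
def brL (β : ℝ) (x y : Fin 6 → ℝ) : Fin 6 → ℝ :=
  ![(1 - β) / 2 * (x 0 * y 4 - x 4 * y 0) + (1 + β) / 2 * (x 0 * y 5 - x 5 * y 0),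
    (1 + β) / 2 * (x 1 * y 4 - x 4 * y 1) + (1 - β) / 2 * (x 1 * y 5 - x 5 * y 1),
    x 2 * y 5 - x 5 * y 2,
    x 3 * y 4 - x 4 * y 3,
    0, 0]

/-- The centred configuration `{±1, ±β}` determines `β ∈ (0,1)` up to affine maps of the line. -/
lemma eq_of_affine_config {β β' n m : ℝ} (hβ : β ∈ Set.Ioo (0 : ℝ) 1)
    (hβ' : β' ∈ Set.Ioo (0 : ℝ) 1)
    (h : ∀ c, c = 1 ∨ c = -1 ∨ c = β ∨ c = -β →
      n + m = c ∨ n - m = c ∨ n + m * β' = c ∨ n - m * β' = c) : β = β' := by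
  obtain ⟨h0, h1⟩ := hβ
  obtain ⟨h0', h1'⟩ := hβ'
  have key : ((m = 1 ∨ m = -1) ∧ (m * β' = β ∨ m * β' = -β)) ∨
      ((m = β ∨ m = -β) ∧ (m * β' = 1 ∨ m * β' = -1)) := by
    have H1 := h 1 (by simp)
    have H2 := h (-1) (by simp)
    have H3 := h β (by simp)
    have H4 := h (-β) (by simp)
    generalize m * β' = k at *
    clear h h0' h1'
    rcases H1 with H1 | H1 | H1 | H1 <;> rcases H2 with H2 | H2 | H2 | H2 <;>
      first
      | (exfalso; linarith)
      | (rcases H3 with H3 | H3 | H3 | H3 <;> rcases H4 with H4 | H4 | H4 | H4 <;>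
          first
          | (exfalso; linarith)
          | exact Or.inl ⟨Or.inl (by linarith), Or.inl (by linarith)⟩
          | exact Or.inl ⟨Or.inl (by linarith), Or.inr (by linarith)⟩
          | exact Or.inl ⟨Or.inr (by linarith), Or.inl (by linarith)⟩
          | exact Or.inl ⟨Or.inr (by linarith), Or.inr (by linarith)⟩
          | exact Or.inr ⟨Or.inl (by linarith), Or.inl (by linarith)⟩
          | exact Or.inr ⟨Or.inl (by linarith), Or.inr (by linarith)⟩
          | exact Or.inr ⟨Or.inr (by linarith), Or.inl (by linarith)⟩
          | exact Or.inr ⟨Or.inr (by linarith), Or.inr (by linarith)⟩)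
  rcases key with ⟨rfl | rfl, hk | hk⟩ | ⟨rfl | rfl, hk | hk⟩ <;> nlinarith

/-- A nonzero `v` in the derived algebra with `[v, z] = a v` has `a` among the weights of `z`. -/
lemma weight_of_eigenvector {β a : ℝ} {v z : Fin 6 → ℝ} (hv : v ≠ 0) (h4 : v 4 = 0)
    (h5 : v 5 = 0) (h : brL β v z = a • v) :
    (1 - β) / 2 * z 4 + (1 + β) / 2 * z 5 = a ∨ (1 + β) / 2 * z 4 + (1 - β) / 2 * z 5 = a ∨
      z 5 = a ∨ z 4 = a := by
  by_contra! hc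
  obtain ⟨c0, c1, c2, c3⟩ := hc
  have g0 := congrFun h 0
  have g1 := congrFun h 1
  have g2 := congrFun h 2
  have g3 := congrFun h 3
  simp [brL, h4, h5] at g0 g1 g2 g3
  refine hv (funext fun i => ?_)
  fin_cases i
  · change v 0 = 0
    exact (mul_eq_zero.mp (by linear_combination g0)).resolve_left (sub_ne_zero.mpr c0)
  · change v 1 = 0
    exact (mul_eq_zero.mp (by linear_combination g1)).resolve_left (sub_ne_zero.mpr c1)
  · change v 2 = 0
    exact (mul_eq_zero.mp (by linear_combination g2)).resolve_left (sub_ne_zero.mpr c2)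
  · change v 3 = 0
    exact (mul_eq_zero.mp (by linear_combination g3)).resolve_left (sub_ne_zero.mpr c3)
  · exact h4
  · exact h5

/-- for distinct `β, β′ ∈ (0,1)` the Lie algebras `L(β)` and `L(β′)` are
not isomorphic, i.e., there is no bijective linear map intertwining the brackets. -/
theorem stmt_18 (β β' : ℝ) (hβ : β ∈ Set.Ioo (0 : ℝ) 1) (hβ' : β' ∈ Set.Ioo (0 : ℝ) 1)
    (hne : β ≠ β') :
    ¬∃ e : (Fin 6 → ℝ) ≃ₗ[ℝ] (Fin 6 → ℝ),
      ∀ x y : Fin 6 → ℝ, e (brL β x y) = brL β' (e x) (e y) := by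
  rintro ⟨e, he⟩
  set z := e (Pi.single 4 1) with hz
  have weight (i : Fin 6) (a : ℝ)
      (h1 : brL β (Pi.single i 1) (Pi.single 4 1 + Pi.single 5 1) = Pi.single i 1)
      (h2 : brL β (Pi.single i 1) (Pi.single 4 1) = a • Pi.single i 1) :
      (1 - β') / 2 * z 4 + (1 + β') / 2 * z 5 = a ∨
        (1 + β') / 2 * z 4 + (1 - β') / 2 * z 5 = a ∨ z 5 = a ∨ z 4 = a := by
    have hd := he (Pi.single i 1) (Pi.single 4 1 + Pi.single 5 1)
    rw [h1] at hd
    refine weight_of_eigenvector (v := e (Pi.single i 1)) ?_ ?_ ?_ ?_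
    · simp
    · rw [hd]; simp [brL]
    · rw [hd]; simp [brL]
    · rw [hz, ← he, h2, map_smul]
  have w0 := weight 0 ((1 - β) / 2) (by ext j; fin_cases j <;> simp [brL]; ring)
    (by ext j; fin_cases j <;> simp [brL])
  have w1 := weight 1 ((1 + β) / 2) (by ext j; fin_cases j <;> simp [brL]; ring)
    (by ext j; fin_cases j <;> simp [brL])
  have w2 := weight 2 0 (by ext j; fin_cases j <;> simp [brL])
    (by ext j; fin_cases j <;> simp [brL])
  have w3 := weight 3 1 (by ext j; fin_cases j <;> simp [brL])
    (by ext j; fin_cases j <;> simp [brL])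
  have centre (a c : ℝ) (hc : 2 * a - 1 = c) (h : (1 - β') / 2 * z 4 + (1 + β') / 2 * z 5 = a ∨
      (1 + β') / 2 * z 4 + (1 - β') / 2 * z 5 = a ∨ z 5 = a ∨ z 4 = a) :
      (z 4 + z 5 - 1) + (z 4 - z 5) = c ∨ (z 4 + z 5 - 1) - (z 4 - z 5) = c ∨
      (z 4 + z 5 - 1) + (z 4 - z 5) * β' = c ∨
      (z 4 + z 5 - 1) - (z 4 - z 5) * β' = c := by
    rcases h with h | h | h | h
    · exact .inr (.inr (.inr (by linear_combination 2 * h + hc)))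
    · exact .inr (.inr (.inl (by linear_combination 2 * h + hc)))
    · exact .inr (.inl (by linear_combination 2 * h + hc))
    · exact .inl (by linear_combination 2 * h + hc)
  refine hne (eq_of_affine_config (n := z 4 + z 5 - 1) (m := z 4 - z 5) hβ hβ' ?_)
  rintro c (rfl | rfl | rfl | rfl)
  · exact centre _ _ (by ring) w3
  · exact centre _ _ (by ring) w2
  · exact centre _ _ (by ring) w1
  · exact centre _ _ (by ring) w0
end
end
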